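/- arXiv:1112.0156 — 2 statements merged into one kernel-verified Lean document; each statement's English description precedes it below -/
import Mathlib

section
/- For every integer n ≥ 1, (n+1)·𝒞_n(q') = Σ_{k=0}^{n} 𝒞_{n-k}(q) · Σ_{i,j ≥ 0, i+j ≤ k} (1-q)^i · (q'-1)^j · binom(n-k+i, i) · binom(n+1, j) · binom(2k-i-j-1, k-i-j), as an identity of polynomials in the two variables q and q', where 𝒞 denotes the large Narayana polynomial and binom(a,j) = a(a-1)···(a-j+1)/j! is the generalized binomial coefficient for integer a (so that in particular binom(-1,0) = 1, which occurs only in the term k = 0). -/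
open Polynomial Finset

/-- The Narayana polynomial `C_n(q)`. -/
noncomputable def narayana (n : ℕ) : Polynomial ℚ :=
  if n = 0 then 1
  else ∑ k ∈ Finset.Icc 1 n,
    Polynomial.C ((n.choose (k - 1) * n.choose k : ℚ) / n) * Polynomial.X ^ (k - 1)

/-- The large Narayana polynomial `𝒞_0 = 1`, `𝒞_n(q) = q·C_n(q)` for `n ≥ 1`. -/
noncomputable def largeNarayana (n : ℕ) : Polynomial ℚ :=
  if n = 0 then 1 else Polynomial.X * narayana n

/-- The generalized binomial coefficient `binom(a,j) = a(a-1)⋯(a-j+1)/j!` for `a : ℤ`. -/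
def gchoose (a : ℤ) (j : ℕ) : ℚ :=
  (∏ i ∈ Finset.range j, ((a : ℚ) - i)) / (Nat.factorial j)

/-- Reciprocal factorial on the integers, zero at negative arguments. -/
def invFactorial : ℤ → ℚ
  | Int.ofNat n => 1 / (n.factorial : ℚ)
  | Int.negSucc _ => 0

theorem invFactorial_natCast (n : ℕ) : invFactorial (n : ℤ) = 1 / (n.factorial : ℚ) := rfl

theorem invFactorial_of_neg {x : ℤ} (hx : x < 0) : invFactorial x = 0 := by
  cases x with
  | ofNat n => exact absurd hx (by simp)
  | negSucc n => rfl

theorem invFactorial_sub_one (x : ℤ) : invFactorial (x - 1) = x * invFactorial x := by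
  rcases lt_trichotomy x 0 with h | h | h
  · rw [invFactorial_of_neg h, invFactorial_of_neg (by omega), mul_zero]
  · subst h
    rw [invFactorial_of_neg (by omega), Int.cast_zero, zero_mul]
  · obtain ⟨n, rfl⟩ : ∃ n : ℕ, x = ((n + 1 : ℕ) : ℤ) := ⟨(x - 1).toNat, by omega⟩
    rw [show ((n + 1 : ℕ) : ℤ) - 1 = (n : ℤ) by push_cast; ring, invFactorial_natCast,
      invFactorial_natCast, Nat.factorial_succ]
    have := Nat.factorial_ne_zero n
    push_cast
    field_simp

/-- The Narayana number `N(n+1,x)`, extended by zero to all integers `x`. -/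
def narayanaNumber (n : ℕ) (x : ℤ) : ℚ :=
  (n + 1).factorial * n.factorial * (invFactorial x * invFactorial (x - 1) *
    (invFactorial (n + 1 - x) * invFactorial (n + 2 - x)))

theorem narayanaNumber_rec (n : ℕ) (x : ℤ) :
    (n + 4) * narayanaNumber (n + 2) x =
      (2 * n + 5) * (narayanaNumber (n + 1) x + narayanaNumber (n + 1) (x - 1)) -
      (n + 1) * (narayanaNumber n x - 2 * narayanaNumber n (x - 1) +
        narayanaNumber n (x - 2)) := by
  have h1 := invFactorial_sub_one x
  have h2 := invFactorial_sub_one (x - 1)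
  have h3 := invFactorial_sub_one (x - 2)
  have k1 := invFactorial_sub_one (n + 4 - x)
  have k2 := invFactorial_sub_one (n + 3 - x)
  have k3 := invFactorial_sub_one (n + 2 - x)
  simp only [narayanaNumber, Nat.factorial_succ]
  push_cast at *
  rw [show x - 1 - 1 = x - 2 by ring] at *
  rw [show x - 2 - 1 = x - 3 by ring] at *
  rw [show (n : ℤ) + 4 - x - 1 = n + 3 - x by ring] at *
  rw [show (n : ℤ) + 3 - x - 1 = n + 2 - x by ring] at *
  rw [show (n : ℤ) + 2 - x - 1 = n + 1 - x by ring] at *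
  rw [show (n : ℤ) + 2 + 1 - x = n + 3 - x by ring, show (n : ℤ) + 2 + 2 - x = n + 4 - x by ring,
    show (n : ℤ) + 1 + 1 - x = n + 2 - x by ring, show (n : ℤ) + 1 + 2 - x = n + 3 - x by ring,
    show (n : ℤ) + 1 + 1 - (x - 1) = n + 3 - x by ring,
    show (n : ℤ) + 1 + 2 - (x - 1) = n + 4 - x by ring,
    show (n : ℤ) + 1 - (x - 1) = n + 2 - x by ring,
    show (n : ℤ) + 2 - (x - 1) = n + 3 - x by ring,
    show (n : ℤ) + 1 - (x - 2) = n + 3 - x by ring,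
    show (n : ℤ) + 2 - (x - 2) = n + 4 - x by ring]
  rw [h3, h2, h1, k3, k2, k1]
  ring

theorem coeff_largeNarayana_succ (n k : ℕ) :
    (largeNarayana (n + 1)).coeff k = narayanaNumber n k := by
  have hf (m : ℕ) : (m.factorial : ℚ) ≠ 0 := by exact_mod_cast m.factorial_ne_zero
  simp only [largeNarayana, narayana, Nat.succ_ne_zero, if_false]
  cases k with
  | zero => simp [narayanaNumber, invFactorial_of_neg]
  | succ k =>
    rw [coeff_X_mul, finsetSum_coeff]
    have : ∀ b ∈ Finset.Icc 1 (n + 1), (Polynomial.C (((n + 1).choose (b - 1) *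
        (n + 1).choose b : ℚ) / ((n + 1 : ℕ) : ℚ)) * X ^ (b - 1)).coeff k =
        if b = k + 1 then ((n + 1).choose (b - 1) *
        (n + 1).choose b : ℚ) / ((n + 1 : ℕ) : ℚ) else 0 := by
      intro b hb
      rw [coeff_C_mul, coeff_X_pow]
      have := (Finset.mem_Icc.1 hb).1
      have : k = b - 1 ↔ b = k + 1 := by omega
      simp [this]
    rw [Finset.sum_congr rfl this, Finset.sum_ite_eq']
    rcases le_or_gt k n with h | h
    · obtain ⟨d, rfl⟩ := Nat.exists_eq_add_of_le h
      rw [if_pos (by simp), Nat.add_sub_cancel, Nat.cast_choose ℚ (by omega : k ≤ k + d + 1),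
        Nat.cast_choose ℚ (by omega : k + 1 ≤ k + d + 1),
        show k + d + 1 - k = d + 1 by omega, show k + d + 1 - (k + 1) = d by omega, narayanaNumber,
        show (((k + 1 : ℕ) : ℤ) - 1) = (k : ℕ) by push_cast; ring,
        show (((k + d : ℕ) : ℤ) + 1 - ((k + 1 : ℕ) : ℤ)) = (d : ℕ) by push_cast; ring,
        show (((k + d : ℕ) : ℤ) + 2 - ((k + 1 : ℕ) : ℤ)) = (d + 1 : ℕ) by push_cast; ring]
      simp only [invFactorial_natCast]
      have h1 := hf (k + 1)
      have h2 := hf k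
      have h3 := hf (d + 1)
      have h4 := hf d
      have h5 : ((k + d + 1 : ℕ) : ℚ) ≠ 0 := by positivity
      field_simp
      rw [Nat.factorial_succ (k + d)]
      push_cast
      ring
    · rw [if_neg (by simp; omega), narayanaNumber,
        invFactorial_of_neg (x := (n : ℤ) + 1 - ((k + 1 : ℕ) : ℤ)) (by push_cast; omega)]
      simp

theorem largeNarayana_rec_succ (n : ℕ) :
    ((n : ℚ[X]) + 4) * largeNarayana (n + 3) =
      (2 * (n : ℚ[X]) + 5) * ((1 + X) * largeNarayana (n + 2)) -
        ((n : ℚ[X]) + 1) * ((1 - X) ^ 2 * largeNarayana (n + 1)) := by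
  have hX (m k : ℕ) : (X * largeNarayana (m + 1)).coeff k = narayanaNumber m ((k : ℤ) - 1) := by
    cases k with
    | zero => simp [narayanaNumber, invFactorial_of_neg]
    | succ k => rw [coeff_X_mul, coeff_largeNarayana_succ]; congr 1; push_cast; ring
  have hXX (m k : ℕ) :
      (X * (X * largeNarayana (m + 1))).coeff k = narayanaNumber m ((k : ℤ) - 2) := by
    cases k with
    | zero => simp [narayanaNumber, invFactorial_of_neg]
    | succ k => rw [coeff_X_mul, hX]; congr 1; push_cast; ring
  rw [show (1 + X) * largeNarayana (n + 2) = largeNarayana (n + 2) + X * largeNarayana (n + 2) by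
    ring, show (1 - X) ^ 2 * largeNarayana (n + 1) = largeNarayana (n + 1) -
      Polynomial.C 2 * (X * largeNarayana (n + 1)) + X * (X * largeNarayana (n + 1)) by
        rw [show Polynomial.C (2 : ℚ) = 2 from rfl]; ring,
    show (n : ℚ[X]) + 4 = Polynomial.C ((n : ℚ) + 4) by simp; rfl,
    show 2 * (n : ℚ[X]) + 5 = Polynomial.C (2 * (n : ℚ) + 5) by simp; rfl,
    show (n : ℚ[X]) + 1 = Polynomial.C ((n : ℚ) + 1) by simp]
  ext k
  simp only [coeff_C_mul, coeff_sub, coeff_add, hX, hXX, coeff_largeNarayana_succ]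
  exact narayanaNumber_rec n k

theorem largeNarayana_zero : largeNarayana 0 = 1 := by simp [largeNarayana]

theorem largeNarayana_one : largeNarayana 1 = X := by simp [largeNarayana, narayana]

theorem largeNarayana_two : largeNarayana 2 = X * (1 + X) := by
  simp [largeNarayana, narayana, Finset.sum_Icc_succ_top]

theorem largeNarayana_rec (n : ℕ) :
    ((n : ℚ[X]) + 3) * largeNarayana (n + 2) =
      (2 * (n : ℚ[X]) + 3) * ((1 + X) * largeNarayana (n + 1)) -
        (n : ℚ[X]) * ((1 - X) ^ 2 * largeNarayana n) := by
  cases n with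
  | zero => simp [largeNarayana_one, largeNarayana_two]; ring
  | succ n =>
    have := largeNarayana_rec_succ n
    push_cast
    linear_combination this

theorem gchoose_natCast (n j : ℕ) : gchoose (n : ℤ) j = n.choose j := by
  induction j with
  | zero => simp [gchoose]
  | succ j ih =>
    have h : gchoose (n : ℤ) (j + 1) * (j + 1) = gchoose (n : ℤ) j * (n - j) := by
      have := Nat.factorial_ne_zero j
      rw [gchoose, gchoose, Finset.prod_range_succ, Nat.factorial_succ]
      push_cast
      field_simp
    have h2 : (n.choose (j + 1) : ℚ) * (j + 1) = n.choose j * (n - j) := by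
      have := Nat.choose_succ_right_eq n j
      rcases le_or_gt j n with hj | hj
      · rw [← Nat.cast_sub hj]; exact_mod_cast this
      · simp [Nat.choose_eq_zero_of_lt hj, Nat.choose_eq_zero_of_lt (Nat.lt_succ_of_lt hj)]
    rw [ih, ← h2] at h
    exact mul_right_cancel₀ (by positivity) h

theorem coeff_geometric_pow {S : Type*} [CommRing S] (a : S) (m i : ℕ) :
    PowerSeries.coeff i ((PowerSeries.rescale a (PowerSeries.mk 1)) ^ (m + 1)) =
      a ^ i * (m + i).choose i := by
  rw [← map_pow, PowerSeries.mk_one_pow_eq_mk_choose_add, PowerSeries.rescale_mk,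
    PowerSeries.coeff_mk, Nat.choose_symm_add]

theorem coeff_one_add_C_mul_X_pow {S : Type*} [CommRing S] (b : S) (n j : ℕ) :
    PowerSeries.coeff j ((1 + PowerSeries.C b * PowerSeries.X) ^ n) = b ^ j * n.choose j := by
  have : (1 + PowerSeries.C b * PowerSeries.X : PowerSeries S) ^ n =
      (((1 + Polynomial.C b * Polynomial.X) ^ n : S[X]) : PowerSeries S) := by simp
  have h : ((1 + Polynomial.C b * Polynomial.X) ^ n : S[X]) =
      ((1 + Polynomial.X) ^ n : S[X]).comp (Polynomial.C b * Polynomial.X) := by simp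
  rw [this, Polynomial.coeff_coe, h, Polynomial.comp_C_mul_X_coeff, Polynomial.coeff_one_add_X_pow,
    mul_comm]

theorem coeff_triple_mul {S : Type*} [CommRing S] (f g h : PowerSeries S)
    (k : ℕ) :
    PowerSeries.coeff k (f * (g * h)) =
      ∑ i ∈ Finset.range (k + 1), ∑ j ∈ Finset.range (k - i + 1),
        PowerSeries.coeff i f * (PowerSeries.coeff j g * PowerSeries.coeff (k - i - j) h) := by
  rw [PowerSeries.coeff_mul, Finset.Nat.sum_antidiagonal_eq_sum_range_succ_mk]
  refine Finset.sum_congr rfl fun i _ => ?_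
  rw [PowerSeries.coeff_mul, Finset.Nat.sum_antidiagonal_eq_sum_range_succ_mk, Finset.mul_sum]

section GeneratingFunction

variable {S : Type*} [CommRing S] [Algebra ℚ S]

/-- The generating function of the large Narayana polynomials evaluated at `q`. -/
noncomputable def narayanaSeries (q : S) : PowerSeries S :=
  PowerSeries.mk fun n => aeval q (largeNarayana n)

theorem aeval_largeNarayana_rec (q : S) (n : ℕ) :
    ((n : S) + 3) * aeval q (largeNarayana (n + 2)) =
      (2 * (n : S) + 3) * ((1 + q) * aeval q (largeNarayana (n + 1))) -
        (n : S) * ((1 - q) ^ 2 * aeval q (largeNarayana n)) := by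
  simpa [map_ofNat] using congrArg (aeval q) (largeNarayana_rec n)

/-- The linear differential equation satisfied by `V = 2zG - (1 + (1-q)z)`, where `G` is the
generating function and `D` is the discriminant of its quadratic equation. -/
theorem narayanaSeries_ode (q : S) (V D : PowerSeries S)
    (hV : V = 2 * PowerSeries.X * narayanaSeries q -
      (1 + PowerSeries.C (1 - q) * PowerSeries.X))
    (hD : D = (1 + PowerSeries.C (1 - q) * PowerSeries.X) ^ 2 - 4 * PowerSeries.X) :
    2 * D * PowerSeries.derivative S V = PowerSeries.derivative S D * V := by
  have hD' : PowerSeries.derivative S D = PowerSeries.C (-2 * (1 + q)) +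
      PowerSeries.C (2 * (1 - q) ^ 2) * PowerSeries.X := by
    rw [hD, pow_two]
    have h4 : PowerSeries.derivative S (4 : PowerSeries S) = 0 :=
      PowerSeries.derivative_C (r := (4 : S))
    simp [Derivation.leibniz, h4, map_ofNat]
    ring
  have hDC : D = 1 + PowerSeries.C (-2 * (1 + q)) * PowerSeries.X +
      PowerSeries.C ((1 - q) ^ 2) * (PowerSeries.X * PowerSeries.X) := by
    rw [hD]; simp [map_ofNat]; ring
  have hv0 : PowerSeries.coeff 0 V = -1 := by
    rw [hV]; simp
  have hv1 : PowerSeries.coeff 1 V = 1 + q := by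
    rw [hV, show 2 * PowerSeries.X * narayanaSeries q =
      PowerSeries.C 2 * (PowerSeries.X * narayanaSeries q) by simp [map_ofNat]; ring]
    simp [narayanaSeries, largeNarayana_zero, PowerSeries.coeff_one]
    ring
  have hv (n : ℕ) : PowerSeries.coeff (n + 2) V = 2 * aeval q (largeNarayana (n + 1)) := by
    rw [hV, show 2 * PowerSeries.X * narayanaSeries q =
      PowerSeries.C 2 * (PowerSeries.X * narayanaSeries q) by simp [map_ofNat]; ring]
    simp [narayanaSeries, PowerSeries.coeff_one, PowerSeries.coeff_succ_X_mul]
  rw [hD', hDC, show (2 : PowerSeries S) * (1 + PowerSeries.C (-2 * (1 + q)) * PowerSeries.X +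
      PowerSeries.C ((1 - q) ^ 2) * (PowerSeries.X * PowerSeries.X)) *
        PowerSeries.derivative S V = PowerSeries.C 2 * (PowerSeries.derivative S V +
        PowerSeries.C (-2 * (1 + q)) * (PowerSeries.X * PowerSeries.derivative S V) +
      PowerSeries.C ((1 - q) ^ 2) * (PowerSeries.X * (PowerSeries.X *
        PowerSeries.derivative S V))) by rw [show PowerSeries.C (2 : S) = 2 from rfl]; ring,
    add_mul, mul_assoc (PowerSeries.C _) PowerSeries.X V]
  ext n
  simp only [map_add, PowerSeries.coeff_C_mul]
  rcases n with _ | _ | _ | n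
  · simp only [PowerSeries.coeff_zero_X_mul, PowerSeries.coeff_derivative, zero_add, hv0, hv1]
    simp
  · have := hv 0
    simp only [PowerSeries.coeff_succ_X_mul, PowerSeries.coeff_zero_X_mul,
      PowerSeries.coeff_derivative, zero_add, hv0, hv1]
    rw [show 1 + 1 = 0 + 2 from rfl, this, zero_add, largeNarayana_one]
    simp
    ring
  · have h0 := hv 0
    have h1 := hv 1
    simp only [PowerSeries.coeff_succ_X_mul, PowerSeries.coeff_derivative, zero_add, hv0,
      hv1] at *
    rw [show 1 + 1 + 1 = 1 + 2 from rfl, h1, h0, largeNarayana_one, largeNarayana_two]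
    simp
    ring
  · have h0 := hv n
    have h1 := hv (n + 1)
    have h2 := hv (n + 2)
    have := aeval_largeNarayana_rec q (n + 1)
    simp only [PowerSeries.coeff_succ_X_mul, PowerSeries.coeff_derivative]
    rw [show n + 1 + 1 + 1 + 1 = n + 2 + 2 from rfl, show n + 1 + 1 + 1 = n + 1 + 2 from rfl,
      h2, h1, h0]
    push_cast at *
    linear_combination 4 * this

theorem eq_of_linear_ode [IsDomain S] (D W : PowerSeries S)
    (hD : PowerSeries.constantCoeff D = 1) (hW : PowerSeries.constantCoeff W = 1)
    (h : D * PowerSeries.derivative S W = PowerSeries.derivative S D * W) : W = D := by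
  have : CharZero S := algebraRat.charZero S
  obtain ⟨u, rfl⟩ : IsUnit D := by rw [PowerSeries.isUnit_iff_constantCoeff, hD]; exact isUnit_one
  have hu : PowerSeries.constantCoeff (↑u⁻¹ : PowerSeries S) = 1 := by
    have := congrArg PowerSeries.constantCoeff u.mul_inv
    rwa [map_mul, hD, one_mul, map_one] at this
  have key : W * (↑u⁻¹ : PowerSeries S) = 1 := by
    apply PowerSeries.derivative.ext
    · rw [Derivation.leibniz, PowerSeries.derivative_inv, PowerSeries.derivative_one, smul_eq_mul,
        smul_eq_mul]
      linear_combination (↑u⁻¹ : PowerSeries S) ^ 2 * h -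
        (↑u⁻¹ : PowerSeries S) * PowerSeries.derivative S W * u.mul_inv
    · rw [map_mul, hW, hu, map_one, one_mul]
  rw [Units.mul_inv_eq_one] at key
  exact key

theorem narayanaSeries_quadratic [IsDomain S] (q : S) :
    PowerSeries.X * narayanaSeries q ^ 2 -
      (1 + PowerSeries.C (1 - q) * PowerSeries.X) * narayanaSeries q + 1 = 0 := by
  have : CharZero S := algebraRat.charZero S
  set V := 2 * PowerSeries.X * narayanaSeries q -
      (1 + PowerSeries.C (1 - q) * PowerSeries.X) with hV
  set D := (1 + PowerSeries.C (1 - q) * PowerSeries.X) ^ 2 - 4 * PowerSeries.X with hD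
  have hode := narayanaSeries_ode q V D hV hD
  have hVD : V ^ 2 = D := by
    apply eq_of_linear_ode D (V ^ 2)
    · simp [hD]
    · simp [hV]
    · rw [pow_two, Derivation.leibniz, smul_eq_mul]
      linear_combination V * hode
  have h4 : (4 : PowerSeries S) ≠ 0 := by
    intro h
    have := congrArg PowerSeries.constantCoeff h
    simp [map_ofNat] at this
  have : 4 * PowerSeries.X * (PowerSeries.X * narayanaSeries q ^ 2 -
      (1 + PowerSeries.C (1 - q) * PowerSeries.X) * narayanaSeries q + 1) = 0 := by
    linear_combination hVD + hD - (V + 2 * PowerSeries.X * narayanaSeries q -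
      (1 + PowerSeries.C (1 - q) * PowerSeries.X)) * hV
  exact (mul_eq_zero.1 this).resolve_left (mul_ne_zero h4 PowerSeries.X_ne_zero)

/-- Substituting `z = w(1-w)/(1-(1-q)w)` rationalizes the generating function; `P` and `A` are the
reciprocals of `1-w` and `1-(1-q)w`. -/
theorem narayanaSeries_subst [IsDomain S] (q : S) (P A : PowerSeries S)
    (hP : P * (1 - PowerSeries.X) = 1)
    (hA : A * (1 - PowerSeries.C (1 - q) * PowerSeries.X) = 1) :
    PowerSeries.subst (PowerSeries.X * (A * (1 - PowerSeries.X))) (narayanaSeries q) =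
      (1 - PowerSeries.C (1 - q) * PowerSeries.X) * P := by
  set z := PowerSeries.X * (A * (1 - PowerSeries.X)) with hz
  have hs : PowerSeries.HasSubst z := PowerSeries.HasSubst.of_constantCoeff_zero' (by simp [hz])
  set H := PowerSeries.subst z (narayanaSeries q) with hH
  have hquad : z * H ^ 2 - (1 + PowerSeries.C (1 - q) * z) * H + 1 = 0 := by
    have := congrArg (PowerSeries.substAlgHom hs) (narayanaSeries_quadratic q)
    have hC : PowerSeries.substAlgHom hs (PowerSeries.C (1 - q)) = PowerSeries.C (1 - q) := by
      rw [PowerSeries.coe_substAlgHom]; exact PowerSeries.subst_C _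
    rw [map_zero, map_add, map_sub, map_mul, map_mul, map_add, map_mul, map_pow, map_one, hC,
      PowerSeries.substAlgHom_X, PowerSeries.coe_substAlgHom, ← hH] at this
    exact this
  set F := (1 - PowerSeries.C (1 - q) * PowerSeries.X) * P with hF
  have hzF : z * F = PowerSeries.X := by
    rw [hz, hF]
    linear_combination PowerSeries.X * (P * (1 - PowerSeries.X)) * hA + PowerSeries.X * hP
  have hFq : z * F ^ 2 - (1 + PowerSeries.C (1 - q) * z) * F + 1 = 0 := by
    linear_combination (F - PowerSeries.C (1 - q)) * hzF - (1 - PowerSeries.X) * hF -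
      (1 - PowerSeries.C (1 - q) * PowerSeries.X) * hP
  have hfac : (H - F) * (z * (H + F) - (1 + PowerSeries.C (1 - q) * z)) = 0 := by
    linear_combination hquad - hFq
  refine sub_eq_zero.1 ((mul_eq_zero.1 hfac).resolve_right fun h => ?_)
  have := congrArg PowerSeries.constantCoeff h
  simp [hz] at this

theorem sum_largeNarayana_mul_pow [IsDomain S] (q : S) (P A K : PowerSeries S)
    (hP : P * (1 - PowerSeries.X) = 1)
    (hA : A * (1 - PowerSeries.C (1 - q) * PowerSeries.X) = 1) (n : ℕ) :
    PowerSeries.coeff n (K * ∑ m ∈ Finset.range (n + 1),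
      PowerSeries.C (aeval q (largeNarayana m)) *
        (PowerSeries.X * (A * (1 - PowerSeries.X))) ^ m) =
      PowerSeries.coeff n (K * ((1 - PowerSeries.C (1 - q) * PowerSeries.X) * P)) := by
  have h := narayanaSeries_subst q P A hP hA
  set z := PowerSeries.X * (A * (1 - PowerSeries.X)) with hz
  have hs : PowerSeries.HasSubst z := PowerSeries.HasSubst.of_constantCoeff_zero' (by simp [hz])
  have hsplit := PowerSeries.eq_X_pow_mul_shift_add_trunc (n + 1) (narayanaSeries q)
  set T := PowerSeries.mk fun i => PowerSeries.coeff (i + (n + 1)) (narayanaSeries q)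
  have h2 := congrArg (PowerSeries.substAlgHom hs) hsplit
  have htr : PowerSeries.substAlgHom hs (PowerSeries.trunc (n + 1) (narayanaSeries q) :
      PowerSeries S) = ∑ m ∈ Finset.range (n + 1),
      PowerSeries.C (aeval q (largeNarayana m)) * z ^ m := by
    rw [PowerSeries.substAlgHom_coe, PowerSeries.trunc_apply, map_sum, Nat.Ico_zero_eq_range]
    refine Finset.sum_congr rfl fun m _ => ?_
    rw [aeval_monomial, narayanaSeries, PowerSeries.coeff_mk]
    rfl
  rw [map_add, map_mul, map_pow, PowerSeries.substAlgHom_X, htr, PowerSeries.coe_substAlgHom,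
    h] at h2
  rw [h2, mul_add, map_add, hz, mul_pow, show K * (PowerSeries.X ^ (n + 1) *
    (A * (1 - PowerSeries.X)) ^ (n + 1) * PowerSeries.subst z T) =
    PowerSeries.X ^ (n + 1) * (K * (A * (1 - PowerSeries.X)) ^ (n + 1) *
      PowerSeries.subst z T) by ring, PowerSeries.coeff_X_pow_mul', if_neg (by omega), zero_add]

theorem coeff_mk_one_pow (k d : ℕ) :
    PowerSeries.coeff d ((PowerSeries.mk 1 : PowerSeries S) ^ k) =
      algebraMap ℚ S (gchoose ((k : ℤ) + d - 1) d) := by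
  cases k with
  | zero =>
    cases d with
    | zero => simp [gchoose]
    | succ d => simp [gchoose, PowerSeries.coeff_one, Finset.prod_range_succ]
  | succ k =>
    rw [PowerSeries.mk_one_pow_eq_mk_choose_add, PowerSeries.coeff_mk,
      show ((k + 1 : ℕ) : ℤ) + d - 1 = ((k + d : ℕ) : ℤ) by push_cast; ring, gchoose_natCast,
      map_natCast, Nat.choose_symm_add]

/-- The Lagrange inversion formula for the large Narayana polynomials. -/
theorem succ_mul_aeval_largeNarayana (q : S) (n : ℕ) (hn : 1 ≤ n) :
    ((n : S) + 1) * aeval q (largeNarayana n) = PowerSeries.coeff n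
      (((1 + PowerSeries.C (q - 1) * PowerSeries.X) * PowerSeries.mk 1) ^ (n + 1)) := by
  have hP := PowerSeries.mk_one_mul_one_sub_eq_one S
  have hBP : (1 + PowerSeries.C (q - 1) * PowerSeries.X) * (PowerSeries.mk 1 : PowerSeries S) =
      PowerSeries.X * (PowerSeries.C q * PowerSeries.mk 1) + 1 := by
    rw [map_sub, map_one]
    linear_combination hP
  obtain ⟨n, rfl⟩ := Nat.exists_eq_add_of_le' hn
  rw [hBP, add_pow, map_sum]
  simp only [one_pow, mul_one, mul_pow, ← map_pow]
  rw [Finset.sum_range_succ', Finset.sum_range_succ]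
  have hterm (k : ℕ) : PowerSeries.coeff (n + 1) (PowerSeries.X ^ (k + 1) *
      (PowerSeries.C (q ^ (k + 1)) * (PowerSeries.mk 1 : PowerSeries S) ^ (k + 1)) *
        ((n + 1 + 1).choose (k + 1) : PowerSeries S)) =
      if k ≤ n then ((n + 2).choose (k + 1) : S) * (q ^ (k + 1) * (n.choose k : S)) else 0 := by
    rw [mul_comm, ← map_natCast (PowerSeries.C (R := S)), PowerSeries.coeff_C_mul,
      PowerSeries.coeff_X_pow_mul', PowerSeries.coeff_C_mul,
      PowerSeries.mk_one_pow_eq_mk_choose_add, PowerSeries.coeff_mk]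
    by_cases h : k ≤ n
    · rw [if_pos (by omega), if_pos h, show k + (n + 1 - (k + 1)) = n by omega]
    · rw [if_neg (by omega), if_neg h, mul_zero]
  simp only [hterm]
  rw [if_neg (by omega)]
  simp only [pow_zero, map_one, one_mul, Nat.choose_zero_right, Nat.cast_one,
    PowerSeries.coeff_one, Nat.succ_ne_zero, if_false, add_zero]
  rw [largeNarayana, if_neg (by omega), narayana, if_neg (by omega), map_mul, map_sum, aeval_X,
    Finset.mul_sum, Finset.mul_sum, Finset.range_eq_Ico,
    show Finset.Icc 1 (n + 1) = Finset.Ico (0 + 1) (n + 1 + 1) from rfl, ← Finset.sum_Ico_add']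
  refine Finset.sum_congr rfl fun x hx => ?_
  rw [if_pos (by have := Finset.mem_Ico.1 hx; omega), Nat.add_sub_cancel, map_mul, map_pow, aeval_X,
    aeval_C]
  have hc : ((n + 1 : ℕ) + 1 : ℚ) * (((n + 1).choose x * (n + 1).choose (x + 1) : ℚ) /
      ((n + 1 : ℕ) : ℚ)) = (n + 2).choose (x + 1) * n.choose x := by
    have h1 : ((n + 1 : ℕ) + 1 : ℚ) * (n + 1).choose x = (n + 2).choose (x + 1) * (x + 1) := by
      exact_mod_cast Nat.add_one_mul_choose_eq (n + 1) x
    have h2 : ((n + 1 : ℕ) : ℚ) * n.choose x = (n + 1).choose (x + 1) * (x + 1) := by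
      exact_mod_cast Nat.add_one_mul_choose_eq n x
    have h3 : ((n + 1 : ℕ) : ℚ) ≠ 0 := by positivity
    rw [← mul_div_assoc, div_eq_iff h3]
    linear_combination ((n + 1).choose (x + 1) : ℚ) * h1 - ((n + 2).choose (x + 1) : ℚ) * h2
  have hcS := congrArg (algebraMap ℚ S) hc
  rw [map_mul, map_add, map_one, map_natCast, map_mul, map_natCast, map_natCast] at hcS
  linear_combination q ^ (x + 1) * hcS

theorem narayana_transition_aeval [IsDomain S] (q q' : S) (n : ℕ) (hn : 1 ≤ n) :
    ((n : S) + 1) * aeval q' (largeNarayana n) =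
      ∑ k ∈ Finset.range (n + 1), aeval q (largeNarayana (n - k)) *
          ∑ i ∈ Finset.range (k + 1), ∑ j ∈ Finset.range (k - i + 1),
            (1 - q) ^ i * (q' - 1) ^ j *
              algebraMap ℚ S (((n - k + i).choose i * (n + 1).choose j : ℚ) *
                  gchoose (2 * k - i - j - 1) (k - i - j)) := by
  set P : PowerSeries S := PowerSeries.mk 1 with hP_def
  set A : PowerSeries S := PowerSeries.rescale (1 - q) P with hA_def
  set B : PowerSeries S := 1 + PowerSeries.C (q' - 1) * PowerSeries.X with hB_def
  have hP : P * (1 - PowerSeries.X) = 1 := PowerSeries.mk_one_mul_one_sub_eq_one S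
  have hA : A * (1 - PowerSeries.C (1 - q) * PowerSeries.X) = 1 := by
    have := congrArg (PowerSeries.rescale (1 - q)) hP
    rwa [map_mul, map_sub, map_one, PowerSeries.rescale_X] at this
  have hterm : ∀ k ∈ Finset.range (n + 1),
      ∑ i ∈ Finset.range (k + 1), ∑ j ∈ Finset.range (k - i + 1),
        (1 - q) ^ i * (q' - 1) ^ j *
          algebraMap ℚ S (((n - k + i).choose i * (n + 1).choose j : ℚ) *
              gchoose (2 * k - i - j - 1) (k - i - j)) =
      PowerSeries.coeff k (A ^ (n - k + 1) * (B ^ (n + 1) * P ^ k)) := by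
    intro k _
    rw [coeff_triple_mul]
    refine Finset.sum_congr rfl fun i hi => Finset.sum_congr rfl fun j hj => ?_
    rw [Finset.mem_range] at hi hj
    rw [hA_def, hP_def, coeff_geometric_pow, hB_def, coeff_one_add_C_mul_X_pow, coeff_mk_one_pow,
      show (k : ℤ) + ((k - i - j : ℕ) : ℤ) - 1 = 2 * k - i - j - 1 by omega]
    simp only [map_mul, map_natCast]
    ring
  rw [Finset.sum_congr rfl fun k hk => by rw [hterm k hk], ← Finset.sum_range_reflect,
    succ_mul_aeval_largeNarayana q' n hn]
  have hK := sum_largeNarayana_mul_pow q P A (B ^ (n + 1) * (P ^ n * A)) hP hA n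
  rw [show B ^ (n + 1) * (P ^ n * A) * ((1 - PowerSeries.C (1 - q) * PowerSeries.X) * P) =
    (B * P) ^ (n + 1) by
      rw [mul_pow B P]
      linear_combination (B ^ (n + 1) * P ^ (n + 1)) * hA] at hK
  rw [← hK, Finset.mul_sum, map_sum]
  refine Finset.sum_congr rfl fun m hm => ?_
  rw [Finset.mem_range] at hm
  obtain ⟨k, rfl⟩ := Nat.exists_eq_add_of_le (Nat.lt_succ_iff.1 hm)
  rw [show m + k + 1 - 1 - m = k by omega, Nat.add_sub_cancel]
  have hPm : P ^ m * (1 - PowerSeries.X) ^ m = 1 := by rw [← mul_pow, hP, one_pow]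
  rw [show B ^ (m + k + 1) * (P ^ (m + k) * A) * (PowerSeries.C (aeval q (largeNarayana m)) *
      (PowerSeries.X * (A * (1 - PowerSeries.X))) ^ m) =
    PowerSeries.C (aeval q (largeNarayana m)) * (PowerSeries.X ^ m *
      (A ^ (m + 1) * (B ^ (m + k + 1) * P ^ k))) by
        rw [mul_pow, mul_pow]
        linear_combination PowerSeries.C (aeval q (largeNarayana m)) * (PowerSeries.X ^ m *
          (A ^ (m + 1) * (B ^ (m + k + 1) * P ^ k))) * hPm,
    PowerSeries.coeff_C_mul, add_comm m k, PowerSeries.coeff_X_pow_mul, add_comm k m]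

end GeneratingFunction

/-- The transition matrix between large Narayana polynomials in two variables
`q = X 0` and `q' = X 1`. -/
theorem narayana_transition (n : ℕ) (hn : 1 ≤ n) :
    ((n : MvPolynomial (Fin 2) ℚ) + 1) *
        Polynomial.aeval (MvPolynomial.X 1) (largeNarayana n) =
      ∑ k ∈ Finset.range (n + 1),
        Polynomial.aeval (MvPolynomial.X 0) (largeNarayana (n - k)) *
          ∑ i ∈ Finset.range (k + 1), ∑ j ∈ Finset.range (k - i + 1),
            (1 - MvPolynomial.X 0) ^ i * (MvPolynomial.X 1 - 1) ^ j *
              MvPolynomial.C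
                (((n - k + i).choose i * (n + 1).choose j : ℚ) *
                  gchoose (2 * k - i - j - 1) (k - i - j)) := by
  simpa only [MvPolynomial.algebraMap_eq] using
    narayana_transition_aeval (MvPolynomial.X 0 : MvPolynomial (Fin 2) ℚ) (MvPolynomial.X 1) n hn
end

section
/- Extend the Narayana polynomials by C_n(q) = 0 for n < 0. For every integer k ≥ 1, the determinant of the k×k matrix whose (i,j)-entry is C_{k-i+j}(q) (1 ≤ i,j ≤ k) equals (-q)^{k(k-1)/2}, and the determinant of the k×k matrix whose (i,j)-entry is C_{k-1-i+j}(q) equals (-q)^{k(k-1)/2}, as identities of polynomials in q. (By the Jacobi–Trudi formula these are the Schur functions s_{k^k} and s_{(k-1)^k} of the alphabet A defined by h_n(A) = C_n(q).) -/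
open Polynomial Finset

/-- The Narayana polynomial extended by `C_n = 0` for `n < 0`. -/
noncomputable def narayanaZ (n : ℤ) : Polynomial ℚ :=
  if n < 0 then 0 else narayana n.toNat

/-- Total weight of the Motzkin prefixes with `n` steps ending at height `k`, where up steps have
weight `1`, down steps weight `q`, and level steps weight `a` at height `0` and `b` above. -/
def motzkinWeight {R : Type*} [CommRing R] (a b q : R) : ℕ → ℕ → R
  | 0, 0 => 1
  | 0, _ + 1 => 0
  | n + 1, 0 => a * motzkinWeight a b q n 0 + q * motzkinWeight a b q n 1
  | n + 1, k + 1 => motzkinWeight a b q n k + b * motzkinWeight a b q n (k + 1)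
      + q * motzkinWeight a b q n (k + 2)

section MotzkinWeight

variable {R : Type*} [CommRing R] (a b q : R)

theorem motzkinWeight_eq_zero_of_lt {n k : ℕ} (h : n < k) : motzkinWeight a b q n k = 0 := by
  induction n generalizing k with
  | zero =>
    obtain ⟨k, rfl⟩ := Nat.exists_eq_succ_of_ne_zero h.ne'
    rfl
  | succ n ih =>
    obtain ⟨k, rfl⟩ := Nat.exists_eq_succ_of_ne_zero (Nat.ne_zero_of_lt h)
    rw [Nat.succ_eq_add_one, motzkinWeight, ih (by omega), ih (by omega), ih (by omega)]
    ring

theorem motzkinWeight_self (n : ℕ) : motzkinWeight a b q n n = 1 := by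
  induction n with
  | zero => rfl
  | succ n ih =>
    rw [motzkinWeight, ih, motzkinWeight_eq_zero_of_lt a b q (by omega),
      motzkinWeight_eq_zero_of_lt a b q (by omega)]
    ring

theorem sum_motzkinWeight_succ_mul_sub (m n N : ℕ) :
    ∑ l ∈ range (N + 1), (motzkinWeight a b q (m + 1) l * motzkinWeight a b q n l -
        motzkinWeight a b q m l * motzkinWeight a b q (n + 1) l) * q ^ l =
      q ^ (N + 1) * (motzkinWeight a b q m (N + 1) * motzkinWeight a b q n N -
        motzkinWeight a b q m N * motzkinWeight a b q n (N + 1)) := by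
  induction N with
  | zero =>
    simp only [sum_range_one, motzkinWeight, zero_add]
    ring
  | succ N ih =>
    rw [sum_range_succ, ih]
    simp only [motzkinWeight]
    ring

theorem sum_motzkinWeight_mul_of_add_lt {m n N : ℕ} (h : m + n < N) :
    ∑ l ∈ range N, motzkinWeight a b q m l * motzkinWeight a b q n l * q ^ l =
      motzkinWeight a b q (m + n) 0 := by
  induction m generalizing n with
  | zero =>
    obtain ⟨N, rfl⟩ := Nat.exists_eq_succ_of_ne_zero (Nat.ne_zero_of_lt h)
    rw [Nat.succ_eq_add_one, sum_range_succ']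
    simp [motzkinWeight]
  | succ m ih =>
    obtain ⟨N, rfl⟩ := Nat.exists_eq_succ_of_ne_zero (Nat.ne_zero_of_lt h)
    have key := sum_motzkinWeight_succ_mul_sub a b q m n N
    rw [motzkinWeight_eq_zero_of_lt a b q (show m < N + 1 by omega),
      motzkinWeight_eq_zero_of_lt a b q (show n < N + 1 by omega), zero_mul, mul_zero,
      sub_zero, mul_zero] at key
    simp only [sub_mul, sum_sub_distrib] at key
    rw [Nat.succ_eq_add_one, sub_eq_zero.mp key, ih (by omega)]
    congr 1
    omega

theorem sum_motzkinWeight_mul {m n N : ℕ} (hm : m < N) :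
    ∑ l ∈ range N, motzkinWeight a b q m l * motzkinWeight a b q n l * q ^ l =
      motzkinWeight a b q (m + n) 0 := by
  rw [← sum_motzkinWeight_mul_of_add_lt a b q (show m + n < N + n by omega)]
  refine sum_subset (range_subset_range.mpr (by omega)) fun l _ hl => ?_
  rw [motzkinWeight_eq_zero_of_lt a b q (by rw [mem_range] at hl; omega), zero_mul, zero_mul]

/-- The Hankel determinant of the moments of a Jacobi continued fraction. -/
theorem det_hankel_motzkinWeight (k : ℕ) :
    (Matrix.of fun i j : Fin k => motzkinWeight a b q (i + j) 0).det =
      q ^ (k * (k - 1) / 2) := by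
  set L : Matrix (Fin k) (Fin k) R := Matrix.of fun i l => motzkinWeight a b q i l
  have hfac : (Matrix.of fun i j : Fin k => motzkinWeight a b q (i + j) 0) =
      L * Matrix.diagonal (fun l : Fin k => q ^ (l : ℕ)) * L.transpose := by
    ext i j
    rw [Matrix.mul_apply]
    simp only [Matrix.mul_diagonal, Matrix.transpose_apply, L, Matrix.of_apply]
    rw [← sum_motzkinWeight_mul a b q i.isLt, ← Fin.sum_univ_eq_sum_range
      (fun l => motzkinWeight a b q i l * motzkinWeight a b q j l * q ^ l)]
    exact sum_congr rfl fun l _ => by ring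
  have hL : L.det = 1 := by
    rw [Matrix.det_of_isLowerTriangular L fun i j hij => motzkinWeight_eq_zero_of_lt a b q hij]
    exact prod_eq_one fun i _ => motzkinWeight_self a b q i
  rw [hfac, Matrix.det_mul, Matrix.det_mul, Matrix.det_transpose, hL, Matrix.det_diagonal,
    Fin.prod_univ_eq_prod_range (fun l => q ^ l), prod_pow_eq_pow_sum, sum_range_id]
  ring

theorem motzkinWeight_one_succ (n : ℕ) :
    motzkinWeight 1 (1 + q) q (n + 1) 0 = motzkinWeight (1 + q) (1 + q) q n 0 ∧
    ∀ k, motzkinWeight 1 (1 + q) q (n + 1) (k + 1) =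
      motzkinWeight (1 + q) (1 + q) q n k + motzkinWeight (1 + q) (1 + q) q n (k + 1) := by
  induction n with
  | zero =>
    refine ⟨by simp [motzkinWeight], fun k => ?_⟩
    cases k <;> simp [motzkinWeight]
  | succ n ih =>
    obtain ⟨h0, hs⟩ := ih
    refine ⟨?_, fun k => ?_⟩
    · rw [motzkinWeight, h0, hs, motzkinWeight]
      ring
    · rw [motzkinWeight, hs, hs]
      cases k with
      | zero =>
        rw [h0]
        simp only [motzkinWeight]
        ring
      | succ k =>
        rw [hs]
        simp only [motzkinWeight]
        ring

end MotzkinWeight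

theorem coeff_motzkinWeight_X (n k : ℕ) :
    (motzkinWeight (1 + X) (1 + X) X n k : ℚ[X]).coeff 0 = n.choose k ∧
    ∀ j, (motzkinWeight (1 + X) (1 + X) X n k : ℚ[X]).coeff (j + 1) =
      n.choose (k + j + 1) * n.choose (j + 1) - n.choose (k + j + 2) * n.choose j := by
  induction n generalizing k with
  | zero =>
    cases k <;> simp [motzkinWeight, coeff_one]
  | succ n ih =>
    have h0 := fun k => (ih k).1
    have hs := fun k => (ih k).2
    cases k with
    | zero =>
      refine ⟨?_, fun j => ?_⟩
      · simp [motzkinWeight, add_mul, h0]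
      · cases j with
        | zero =>
          simp [motzkinWeight, add_mul, coeff_X_mul, h0, hs, Nat.choose_succ_succ']
          ring
        | succ j =>
          simp only [motzkinWeight, add_mul, one_mul, coeff_add, coeff_X_mul, hs,
            show 0 + (j + 1) + 1 = j + 1 + 1 by ring,
            show 0 + (j + 1) + 2 = j + 2 + 1 by ring,
            show 0 + j + 1 = j + 1 by ring,
            show 0 + j + 2 = j + 2 by ring,
            show 1 + j + 1 = j + 2 by ring,
            show 1 + j + 2 = j + 3 by ring, Nat.choose_succ_succ', Nat.cast_add]
          ring
    | succ k =>
      refine ⟨?_, fun j => ?_⟩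
      · simp [motzkinWeight, add_mul, h0, Nat.choose_succ_succ']
      · cases j with
        | zero =>
          simp [motzkinWeight, add_mul, coeff_X_mul, h0, hs, Nat.choose_succ_succ']
          ring
        | succ j =>
          simp only [motzkinWeight, add_mul, one_mul, coeff_add, coeff_X_mul, hs,
            show k + 1 + (j + 1) + 1 = k + j + 2 + 1 by ring,
            show k + 1 + (j + 1) + 2 = k + j + 3 + 1 by ring,
            show k + (j + 1) + 1 = k + j + 2 by ring,
            show k + (j + 1) + 2 = k + j + 3 by ring,
            show k + 1 + j + 1 = k + j + 2 by ring,
            show k + 1 + j + 2 = k + j + 3 by ring,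
            show k + 2 + j + 1 = k + j + 3 by ring,
            show k + 2 + j + 2 = k + j + 4 by ring, Nat.choose_succ_succ', Nat.cast_add]
          ring

theorem coeff_narayana_succ (n j : ℕ) :
    (narayana (n + 1)).coeff j = ((n + 1).choose j * (n + 1).choose (j + 1) : ℚ) / (n + 1) := by
  simp only [narayana, Nat.succ_ne_zero, if_false, finsetSum_coeff, coeff_C_mul, coeff_X_pow]
  rw [sum_eq_single (j + 1)]
  · simp
  · intro l hl hne
    rw [mem_Icc] at hl
    rw [if_neg (by omega), mul_zero]
  · intro hj
    rw [Nat.choose_eq_zero_of_lt (show n + 1 < j + 1 by simp at hj; omega)]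
    simp

theorem cast_choose_succ_right_mul (n j : ℕ) :
    (n.choose (j + 1) : ℚ) * (j + 1) = n.choose j * (n - j) := by
  rcases le_or_gt j n with h | h
  · rw [← Nat.cast_sub h]
    exact_mod_cast Nat.choose_succ_right_eq n j
  · simp [Nat.choose_eq_zero_of_lt h, Nat.choose_eq_zero_of_lt (h.trans (Nat.lt_succ_self j))]

theorem narayana_succ (n : ℕ) :
    narayana (n + 1) = motzkinWeight (1 + X) (1 + X) X n 0 := by
  ext j
  rw [coeff_narayana_succ]
  have hn : (n + 1 : ℚ) ≠ 0 := by positivity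
  cases j with
  | zero =>
    rw [(coeff_motzkinWeight_X n 0).1]
    simp [hn]
  | succ j =>
    rw [(coeff_motzkinWeight_X n 0).2]
    have hb : (n.choose (j + 1) : ℚ) = n.choose j * (n - j) / (j + 1) := by
      rw [eq_div_iff (by positivity), cast_choose_succ_right_mul]
    have hc : (n.choose (j + 2) : ℚ) = n.choose (j + 1) * (n - (j + 1)) / (j + 2) := by
      have := cast_choose_succ_right_mul n (j + 1)
      rw [eq_div_iff (by positivity)]
      push_cast at this
      linear_combination this
    rw [div_eq_iff hn, zero_add, Nat.choose_succ_succ', Nat.choose_succ_succ', Nat.cast_add,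
      Nat.cast_add, hc, hb]
    field_simp
    ring

theorem narayana_eq_motzkinWeight_one (n : ℕ) :
    narayana n = motzkinWeight 1 (1 + X) X n 0 := by
  cases n with
  | zero => simp [narayana, motzkinWeight]
  | succ n => rw [narayana_succ, (motzkinWeight_one_succ X n).1]

theorem narayanaZ_natCast (n : ℕ) : narayanaZ n = narayana n := by
  simp [narayanaZ]

theorem sign_revPerm (k : ℕ) :
    Equiv.Perm.sign (Fin.revPerm : Equiv.Perm (Fin k)) = (-1) ^ (k * (k - 1) / 2) := by
  rw [Equiv.Perm.sign_eq_prod_prod_Iio]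
  have h : ∀ j : Fin k, ∏ i ∈ Iio j, (if Fin.revPerm i < Fin.revPerm j then (1 : ℤˣ) else -1) =
      (-1) ^ (j : ℕ) := fun j => by
    rw [prod_congr rfl fun i hi => if_neg (by simpa using (mem_Iio.mp hi).le), prod_const,
      Fin.card_Iio]
  simp only [h]
  rw [Fin.prod_univ_eq_prod_range (fun l => (-1 : ℤˣ) ^ l), prod_pow_eq_pow_sum, sum_range_id]

theorem det_eq_neg_pow_of_reverse_rows {R : Type*} [CommRing R] (k : ℕ) (q : R)
    (A : Matrix (Fin k) (Fin k) R)
    (h : (A.submatrix Fin.revPerm id).det = q ^ (k * (k - 1) / 2)) :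
    A.det = (-q) ^ (k * (k - 1) / 2) := by
  rw [Matrix.det_permute, sign_revPerm] at h
  rw [neg_pow, ← h, ← mul_assoc]
  push_cast
  rw [← mul_pow]
  simp

/-- The Jacobi–Trudi determinants `s_{k^k}` and `s_{(k-1)^k}` of the Narayana
alphabet both equal `(-q)^{k(k-1)/2}`. -/
theorem narayana_schur_det (k : ℕ) (hk : 1 ≤ k) :
    (Matrix.det (Matrix.of fun i j : Fin k =>
        narayanaZ ((k : ℤ) - (i + 1) + (j + 1))) =
      (-Polynomial.X) ^ (k * (k - 1) / 2)) ∧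
    (Matrix.det (Matrix.of fun i j : Fin k =>
        narayanaZ ((k : ℤ) - 1 - (i + 1) + (j + 1))) =
      (-Polynomial.X) ^ (k * (k - 1) / 2)) := by
  have hhankel : ∀ a : ℚ[X], (Matrix.of fun i j : Fin k =>
      motzkinWeight a (1 + X) X (i + j) 0).det = X ^ (k * (k - 1) / 2) :=
    fun a => det_hankel_motzkinWeight a (1 + X) X k
  constructor
  · refine det_eq_neg_pow_of_reverse_rows k X _ ?_
    rw [← hhankel (1 + X)]
    congr 1
    ext1 i j
    have hi : (k : ℤ) - ((Fin.revPerm i : Fin k) + 1) + (j + 1) = ((i + j + 1 : ℕ) : ℤ) := by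
      rw [Fin.revPerm_apply, Fin.val_rev]
      omega
    simp only [Matrix.submatrix_apply, Matrix.of_apply, id, hi, narayanaZ_natCast, narayana_succ]
  · refine det_eq_neg_pow_of_reverse_rows k X _ ?_
    rw [← hhankel 1]
    congr 1
    ext1 i j
    have hi : (k : ℤ) - 1 - ((Fin.revPerm i : Fin k) + 1) + (j + 1) = ((i + j : ℕ) : ℤ) := by
      rw [Fin.revPerm_apply, Fin.val_rev]
      omega
    simp only [Matrix.submatrix_apply, Matrix.of_apply, id, hi, narayanaZ_natCast,
      narayana_eq_motzkinWeight_one]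
end
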